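/- If f : X → Y is a local homeomorphism between locally connected Hausdorff spaces and U ⊆ Y is portly in Y, then f⁻¹(U) is portly in X. -/

import Mathlib

/-- A subset `U` of a topological space `X` is *portly* if it is open, dense, and
locally connected in `X`, i.e. its intersection with every open connected subset
of `X` is connected. -/
def Portly (X : Type*) [TopologicalSpace X] (U : Set X) : Prop :=
  IsOpen U ∧ Dense U ∧ ∀ W : Set X, IsOpen W → IsConnected W → IsConnected (W ∩ U)

theorem stmt5 {X Y : Type*} [TopologicalSpace X] [TopologicalSpace Y]
    [T2Space X] [T2Space Y] [LocallyConnectedSpace X] [LocallyConnectedSpace Y]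
    (f : X → Y) (hf : IsLocalHomeomorph f) (U : Set Y) (hU : Portly Y U) :
    Portly X (f ⁻¹' U) := by
  obtain ⟨hUo, hUd, hUc⟩ := hU
  have hVo : IsOpen (f ⁻¹' U) := hUo.preimage hf.continuous
  have hVd : Dense (f ⁻¹' U) := hUd.preimage hf.isOpenMap
  refine ⟨hVo, hVd, fun W hW hWc => ⟨hVd.inter_open_nonempty W hW hWc.nonempty, ?_⟩⟩
  have key : ∀ x ∈ W, ∃ N : Set X, IsOpen N ∧ x ∈ N ∧ N ⊆ W ∧
      IsPreconnected (N ∩ f ⁻¹' U) := by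
    intro x hx
    obtain ⟨e, hxe, he⟩ := hf x
    have hmem : W ∩ e.source ∈ nhds x := (hW.inter e.open_source).mem_nhds ⟨hx, hxe⟩
    obtain ⟨N, hNs, hNo, hxN, hNc⟩ :=
      (locallyConnectedSpace_iff_subsets_isOpen_isConnected.1 inferInstance) x _ hmem
    refine ⟨N, hNo, hxN, fun z hz => (hNs hz).1, ?_⟩
    have h1 := (hUc (f '' N) (hf.isOpenMap N hNo)
      (hNc.image f hf.continuous.continuousOn)).isPreconnected
    have h2 : IsPreconnected (e.symm '' (f '' N ∩ U)) := by
      refine h1.image _ (e.continuousOn_symm.mono ?_)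
      rintro _ ⟨⟨z, hz, rfl⟩, _⟩
      rw [he]
      exact e.map_source (hNs hz).2
    convert h2 using 1
    ext z
    constructor
    · rintro ⟨hz, hzU⟩
      refine ⟨f z, ⟨⟨z, hz, rfl⟩, hzU⟩, ?_⟩
      rw [he]
      exact e.left_inv (hNs hz).2
    · rintro ⟨_, ⟨⟨y, hy, rfl⟩, hyU⟩, rfl⟩
      have hh : e.symm (f y) = y := by
        rw [he]
        exact e.left_inv (hNs hy).2
      rw [hh]
      exact ⟨hy, hyU⟩
  intro A B hA hB hAB hAn hBn
  by_contra hne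
  let S : Set X → Set X := fun C => ⋃₀ {N | IsOpen N ∧ N ⊆ W ∧ N ∩ f ⁻¹' U ⊆ C}
  have hSo : ∀ C, IsOpen (S C) := fun C => isOpen_sUnion fun N hN => hN.1
  have hSn : ∀ C, IsOpen C → ((W ∩ f ⁻¹' U) ∩ C).Nonempty → (W ∩ S C).Nonempty := by
    rintro C hC ⟨x, hx⟩
    exact ⟨x, hx.1.1, (W ∩ f ⁻¹' U) ∩ C,
      ⟨(hW.inter hVo).inter hC, fun z hz => hz.1.1, fun z hz => hz.1.2⟩, hx⟩
  have hcov : W ⊆ S A ∪ S B := by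
    intro x hx
    obtain ⟨N, hNo, hxN, hNW, hNc⟩ := key x hx
    by_cases h1 : N ∩ f ⁻¹' U ⊆ A
    · exact Or.inl ⟨N, ⟨hNo, hNW, h1⟩, hxN⟩
    by_cases h2 : N ∩ f ⁻¹' U ⊆ B
    · exact Or.inr ⟨N, ⟨hNo, hNW, h2⟩, hxN⟩
    exfalso
    obtain ⟨a, ha, haA⟩ := Set.not_subset.1 h1
    obtain ⟨b, hb, hbB⟩ := Set.not_subset.1 h2
    have hsub : N ∩ f ⁻¹' U ⊆ W ∩ f ⁻¹' U := Set.inter_subset_inter_left _ hNW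
    obtain ⟨z, hz, hz'⟩ := hNc A B hA hB (hsub.trans hAB)
      ⟨b, hb, (hAB (hsub hb)).resolve_right hbB⟩
      ⟨a, ha, (hAB (hsub ha)).resolve_left haA⟩
    exact hne ⟨z, hsub hz, hz'⟩
  obtain ⟨x, hx, ⟨N, ⟨hNo, hNW, hNA⟩, hxN⟩, ⟨M, ⟨hMo, hMW, hMB⟩, hxM⟩⟩ :=
    hWc.isPreconnected (S A) (S B) (hSo A) (hSo B) hcov (hSn A hA hAn) (hSn B hB hBn)
  obtain ⟨z, ⟨hzN, hzM⟩, hzV⟩ := hVd.inter_open_nonempty (N ∩ M) (hNo.inter hMo) ⟨x, hxN, hxM⟩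
  exact hne ⟨z, ⟨hNW hzN, hzV⟩, hNA ⟨hzN, hzV⟩, hMB ⟨hzM, hzV⟩⟩
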